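/- For every M > 0 there exists a constant C > 0 (depending only on M) such that for every n ≥ 1 and every measurable decision rule a : ℝⁿ → [0,1]ⁿ, sup over μ ∈ [−1,1]ⁿ of [ sup_{β ∈ [−M,M]} (1/n) Σ_{i=1}^n μ_i Φ(μ_i − β) − (1/n) Σ_{i=1}^n μ_i E_{Y ~ N(μ, I_n)}[a_i(Y₁,…,Y_n)] ] ≥ C/√n, where Y = (Y₁,…,Y_n) has independent coordinates Y_i ~ N(μ_i, 1). -/

import Mathlib

open MeasureTheory ProbabilityTheory Filter

/-- standard normal density -/
noncomputable def phiR (x : ℝ) : ℝ := (Real.sqrt (2 * Real.pi))⁻¹ * Real.exp (-(x ^ 2) / 2)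

/-- standard normal CDF -/
noncomputable def PhiR (x : ℝ) : ℝ := ∫ t in Set.Iic x, phiR t

lemma phiR_eq : phiR = gaussianPDFReal 0 1 := by
  ext x
  simp [phiR, gaussianPDFReal]

lemma phiR_int : Integrable phiR := by
  rw [phiR_eq]; exact integrable_gaussianPDFReal 0 1

lemma phiR_pos (x : ℝ) : 0 < phiR x := by
  rw [phiR_eq]; exact gaussianPDFReal_pos 0 1 x one_ne_zero

lemma PhiR_nonneg (x : ℝ) : 0 ≤ PhiR x :=
  integral_nonneg fun t => (phiR_pos t).le

lemma PhiR_le_one (x : ℝ) : PhiR x ≤ 1 := by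
  have h : ∫ t, phiR t = 1 := by
    rw [phiR_eq]; exact integral_gaussianPDFReal_eq_one 0 one_ne_zero
  rw [← h]
  exact setIntegral_le_integral phiR_int (Eventually.of_forall fun t => (phiR_pos t).le)

lemma PhiR_lt {x y : ℝ} (h : x < y) : PhiR x < PhiR y := by
  have h1 := intervalIntegral.integral_Iic_sub_Iic (a := x) (b := y) (f := phiR) (μ := volume)
    phiR_int.integrableOn phiR_int.integrableOn
  have h2 : 0 < ∫ t in x..y, phiR t :=
    intervalIntegral.intervalIntegral_pos_of_pos phiR_int.intervalIntegrable phiR_pos h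
  unfold PhiR
  linarith

lemma gauss_shift (δ : ℝ) (s : Set ℝ) (hs : MeasurableSet s) :
    gaussianReal δ 1 s = ENNReal.ofReal
      (∫ x, s.indicator (fun x => Real.exp (2 * δ * x)) x ∂(gaussianReal (-δ) 1)) := by
  rw [gaussianReal_apply_eq_integral _ one_ne_zero,
    integral_gaussianReal_eq_integral_smul one_ne_zero, ← integral_indicator hs]
  congr 2
  ext x
  by_cases hx : x ∈ s
  · simp only [hx, Set.indicator_of_mem, smul_eq_mul, gaussianPDFReal]
    rw [mul_assoc _ (Real.exp _) (Real.exp _), ← Real.exp_add]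
    congr 2
    simp
    ring
  · simp [hx]

lemma pi_shift (n : ℕ) (δ : ℝ) :
    Measure.pi (fun _ : Fin n => gaussianReal δ 1) =
      (Measure.pi (fun _ : Fin n => gaussianReal (-δ) 1)).withDensity
        (fun y => ENNReal.ofReal (∏ i, Real.exp (2 * δ * y i))) := by
  apply Measure.pi_eq
  intro s hs
  have hS : MeasurableSet (Set.univ.pi s) := MeasurableSet.univ_pi hs
  rw [withDensity_apply _ hS, ← lintegral_indicator hS]
  have h1 : ∀ y : Fin n → ℝ, (Set.univ.pi s).indicator
      (fun y => ENNReal.ofReal (∏ i, Real.exp (2 * δ * y i))) y =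
      ENNReal.ofReal (∏ i, (s i).indicator (fun x => Real.exp (2 * δ * x)) (y i)) := by
    intro y
    by_cases hy : y ∈ Set.univ.pi s
    · rw [Set.indicator_of_mem hy]
      congr 1
      refine Finset.prod_congr rfl fun i _ => ?_
      rw [Set.indicator_of_mem (hy i (Set.mem_univ i))]
    · rw [Set.indicator_of_notMem hy]
      obtain ⟨i, hi⟩ : ∃ i, y i ∉ s i := by simpa [Set.mem_pi] using hy
      rw [Finset.prod_eq_zero (Finset.mem_univ i) (Set.indicator_of_notMem hi _)]
      simp
  simp_rw [h1]
  have hnn : ∀ i x, 0 ≤ (s i).indicator (fun x => Real.exp (2 * δ * x)) x :=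
    fun i x => Set.indicator_nonneg (fun _ _ => (Real.exp_pos _).le) x
  rw [← ofReal_integral_eq_lintegral_ofReal]
  · rw [integral_fintype_prod_eq_prod
      (f := fun i x => (s i).indicator (fun x => Real.exp (2 * δ * x)) x),
      ENNReal.ofReal_prod_of_nonneg (fun i _ => integral_nonneg (hnn i))]
    exact Finset.prod_congr rfl fun i _ => (gauss_shift δ (s i) (hs i)).symm
  · apply Integrable.fintype_prod (f := fun i x => (s i).indicator (fun x => Real.exp (2 * δ * x)) x)
    intro i
    exact (integrable_exp_mul_gaussianReal _).indicator (hs i)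
  · exact Eventually.of_forall fun y => Finset.prod_nonneg fun i _ => hnn i _

lemma prod_int (n : ℕ) (δ t : ℝ) :
    Integrable (fun y : Fin n → ℝ => ∏ i, Real.exp (t * y i))
      (Measure.pi (fun _ : Fin n => gaussianReal δ 1)) :=
  Integrable.fintype_prod (f := fun _ x => Real.exp (t * x))
    fun _ => integrable_exp_mul_gaussianReal _

lemma prod_integral (n : ℕ) (δ t : ℝ) :
    ∫ y : Fin n → ℝ, ∏ i, Real.exp (t * y i) ∂(Measure.pi (fun _ : Fin n => gaussianReal δ 1))
      = Real.exp (n * (δ * t + t ^ 2 / 2)) := by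
  rw [integral_fintype_prod_eq_prod (f := fun _ x => Real.exp (t * x))]
  have := congrFun (mgf_fun_id_gaussianReal (μ := δ) (v := 1)) t
  simp only [mgf] at this
  simp [this, ← Real.exp_nat_mul]

lemma tv_bound (n : ℕ) (δ ε : ℝ) (hε : 0 < ε) (A : (Fin n → ℝ) → ℝ) (hA : Measurable A)
    (hA01 : ∀ y, A y ∈ Set.Icc (0:ℝ) 1) :
    ∫ y, A y ∂(Measure.pi (fun _ : Fin n => gaussianReal δ 1))
      - ∫ y, A y ∂(Measure.pi (fun _ : Fin n => gaussianReal (-δ) 1))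
      ≤ ε / 2 + (Real.exp (n * (4 * δ ^ 2)) - 1) / (2 * ε) := by
  set Q := Measure.pi (fun _ : Fin n => gaussianReal (-δ) 1) with hQ
  set L : (Fin n → ℝ) → ℝ := fun y => ∏ i, Real.exp (2 * δ * y i) with hL
  have hL0 : ∀ y, 0 ≤ L y := fun y => Finset.prod_nonneg fun i _ => (Real.exp_pos _).le
  have hLm : Measurable L := by fun_prop
  have hLint : Integrable L Q := prod_int n (-δ) (2 * δ)
  have hL1 : ∫ y, L y ∂Q = 1 := by
    rw [hQ, hL, prod_integral]
    rw [Real.exp_eq_one_iff]; ring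
  have hL2 : (fun y => L y ^ 2) = fun y => ∏ i, Real.exp (4 * δ * y i) := by
    ext y
    rw [hL, ← Finset.prod_pow]
    refine Finset.prod_congr rfl fun i _ => ?_
    rw [← Real.exp_nat_mul]; congr 1; push_cast; ring
  have hL2int : Integrable (fun y => L y ^ 2) Q := by
    rw [hL2]; exact prod_int n (-δ) (4 * δ)
  have hL2I : ∫ y, L y ^ 2 ∂Q = Real.exp (n * (4 * δ ^ 2)) := by
    rw [hL2, hQ, prod_integral]; congr 1; ring
  have hAint : Integrable A Q := by
    refine Integrable.of_bound hA.aestronglyMeasurable 1 (Eventually.of_forall fun y => ?_)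
    rw [Real.norm_eq_abs, abs_le]; constructor <;> linarith [(hA01 y).1, (hA01 y).2]
  have hLA : Integrable (fun y => L y * A y) Q := by
    refine hLint.mono' (hLm.mul hA).aestronglyMeasurable (Eventually.of_forall fun y => ?_)
    rw [Real.norm_eq_abs, abs_of_nonneg (mul_nonneg (hL0 y) (hA01 y).1)]
    exact mul_le_of_le_one_right (hL0 y) (hA01 y).2
  have hP : ∫ y, A y ∂(Measure.pi (fun _ : Fin n => gaussianReal δ 1)) = ∫ y, L y * A y ∂Q := by
    rw [pi_shift, integral_withDensity_eq_integral_toReal_smul (by fun_prop)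
      (Eventually.of_forall fun y => ENNReal.ofReal_lt_top)]
    refine integral_congr_ae (Eventually.of_forall fun y => ?_)
    simp only [smul_eq_mul]
    rw [ENNReal.toReal_ofReal (hL0 y)]
  rw [hP, ← integral_sub hLA hAint]
  have hR : Integrable (fun y => ε / 2 + (L y ^ 2 - 2 * L y + 1) / (2 * ε)) Q :=
    (integrable_const _).add
      (((hL2int.sub (hLint.const_mul 2)).add (integrable_const _)).div_const _)
  have hRI : ∫ y, (ε / 2 + (L y ^ 2 - 2 * L y + 1) / (2 * ε)) ∂Q
      = ε / 2 + (Real.exp (n * (4 * δ ^ 2)) - 1) / (2 * ε) := by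
    have i1 : Integrable (fun y => L y ^ 2 - 2 * L y) Q := hL2int.sub (hLint.const_mul 2)
    have i2 : Integrable (fun y => L y ^ 2 - 2 * L y + 1) Q := i1.add (integrable_const _)
    rw [integral_add (integrable_const _) (i2.div_const _),
      integral_div, integral_div, integral_add i1 (integrable_const _),
      integral_sub hL2int (hLint.const_mul 2), integral_const_mul, hL1, hL2I]
    simp
    ring
  rw [← hRI]
  refine integral_mono (hLA.sub hAint) hR fun y => ?_
  have h0 := (hA01 y).1
  have h1 := (hA01 y).2
  have key : ε / 2 + (L y ^ 2 - 2 * L y + 1) / (2 * ε) - (L y * A y - A y)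
      = ((ε - A y * (L y - 1)) ^ 2 + (1 - A y ^ 2) * (L y - 1) ^ 2) / (2 * ε) := by
    field_simp; ring
  have : 0 ≤ ((ε - A y * (L y - 1)) ^ 2 + (1 - A y ^ 2) * (L y - 1) ^ 2) / (2 * ε) := by
    have : 0 ≤ 1 - A y ^ 2 := by nlinarith
    positivity
  simp only
  linarith

/-- √n minimax lower bound for compound selection regret in the
homoskedastic unit-variance, zero-cost Gaussian case. -/
theorem regret_lower_bound (M : ℝ) (hM : 0 < M) :
    ∃ c : ℝ, 0 < c ∧
      ∀ n : ℕ, 1 ≤ n →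
        ∀ a : (Fin n → ℝ) → Fin n → ℝ,
          Measurable a → (∀ y i, a y i ∈ Set.Icc (0:ℝ) 1) →
          c / Real.sqrt n ≤
            ⨆ μ : {μ : Fin n → ℝ // ∀ i, μ i ∈ Set.Icc (-1:ℝ) 1},
              ((⨆ β : Set.Icc (-M) M,
                  (1 / (n:ℝ)) * ∑ i, μ.1 i * PhiR (μ.1 i - (β : ℝ)))
                - ∫ y, (1 / (n:ℝ)) * ∑ i, μ.1 i * a y i
                    ∂(Measure.pi fun i => gaussianReal (μ.1 i) 1)) := by
  set κ := PhiR M - PhiR (-M) with hκ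
  have hκ0 : 0 < κ := sub_pos.2 (PhiR_lt (by linarith))
  have hκ1 : κ ≤ 1 := by linarith [PhiR_le_one M, PhiR_nonneg (-M)]
  refine ⟨κ ^ 2 / 32, by positivity, ?_⟩
  intro n hn a ha ha01
  have hn0 : (0:ℝ) < n := by exact_mod_cast hn
  have hsq : 1 ≤ Real.sqrt n := by
    rw [Real.one_le_sqrt]; exact_mod_cast hn
  set δ := κ / 8 / Real.sqrt n with hδ
  have hδ0 : 0 < δ := by positivity
  have hδ1 : δ ≤ 1 := by
    rw [hδ, div_le_one (by linarith)]; linarith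
  have hδ2 : n * (4 * δ ^ 2) = κ ^ 2 / 16 := by
    rw [hδ, div_pow, Real.sq_sqrt hn0.le]; field_simp; norm_num
  set A : (Fin n → ℝ) → ℝ := fun y => (1 / (n:ℝ)) * ∑ i, a y i with hA
  have hAm : Measurable A := by
    have : ∀ i, Measurable fun y => a y i := fun i => (measurable_pi_apply i).comp ha
    fun_prop
  have hA01 : ∀ y, A y ∈ Set.Icc (0:ℝ) 1 := by
    intro y
    constructor
    · exact mul_nonneg (by positivity) (Finset.sum_nonneg fun i _ => (ha01 y i).1)
    · have : ∑ i, a y i ≤ n := by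
        simpa using Finset.sum_le_sum (s := Finset.univ) fun i _ => (ha01 y i).2
      rw [hA]
      simp only
      rw [one_div, inv_mul_le_iff₀ hn0]
      linarith
  -- generic bound
  have avg : ∀ w : Fin n → ℝ, (∀ i, |w i| ≤ 1) → |(1 / (n:ℝ)) * ∑ i, w i| ≤ 1 := by
    intro w hw
    rw [abs_mul, abs_of_nonneg (by positivity), one_div, inv_mul_le_iff₀ hn0]
    calc |∑ i, w i| ≤ ∑ i, |w i| := Finset.abs_sum_le_sum_abs _ _
      _ ≤ ∑ _i : Fin n, (1:ℝ) := Finset.sum_le_sum fun i _ => hw i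
      _ = n * 1 := by simp
  have prod1 : ∀ x y : ℝ, x ∈ Set.Icc (-1:ℝ) 1 → 0 ≤ y → y ≤ 1 → |x * y| ≤ 1 := by
    intro x y hx h0 h1
    rw [abs_mul]
    exact mul_le_one₀ (abs_le.2 hx) (abs_nonneg _) (by rwa [abs_of_nonneg h0])
  have W1 : ∀ (μ : {μ : Fin n → ℝ // ∀ i, μ i ∈ Set.Icc (-1:ℝ) 1}) (β : Set.Icc (-M) M),
      (1 / (n:ℝ)) * ∑ i, μ.1 i * PhiR (μ.1 i - (β : ℝ)) ≤ 1 := fun μ β =>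
    (abs_le.1 (avg _ fun i => prod1 _ _ (μ.2 i) (PhiR_nonneg _) (PhiR_le_one _))).2
  haveI : Nonempty (Set.Icc (-M) M) := ⟨⟨M, by constructor <;> linarith⟩⟩
  have hbdd : BddAbove (Set.range fun μ : {μ : Fin n → ℝ // ∀ i, μ i ∈ Set.Icc (-1:ℝ) 1} =>
      ((⨆ β : Set.Icc (-M) M,
                  (1 / (n:ℝ)) * ∑ i, μ.1 i * PhiR (μ.1 i - (β : ℝ)))
                - ∫ y, (1 / (n:ℝ)) * ∑ i, μ.1 i * a y i
                    ∂(Measure.pi fun i => gaussianReal (μ.1 i) 1))) := by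
    refine ⟨2, ?_⟩
    rintro _ ⟨μ, rfl⟩
    have h1 : (⨆ β : Set.Icc (-M) M,
        (1 / (n:ℝ)) * ∑ i, μ.1 i * PhiR (μ.1 i - (β : ℝ))) ≤ 1 := ciSup_le (W1 μ)
    have h2 := norm_integral_le_of_norm_le_const
      (μ := Measure.pi fun i => gaussianReal (μ.1 i) 1)
      (f := fun y => (1 / (n:ℝ)) * ∑ i, μ.1 i * a y i) (C := 1)
      (Eventually.of_forall fun y => avg _ fun i =>
        prod1 _ _ (μ.2 i) (ha01 y i).1 (ha01 y i).2)
    simp only [Real.norm_eq_abs, probReal_univ, mul_one] at h2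
    have h3 := (abs_le.1 h2).1
    simp only
    linarith
  have point : ∀ (θ β : ℝ), θ ∈ Set.Icc (-1:ℝ) 1 → β ∈ Set.Icc (-M) M →
      θ * PhiR (θ - β) - θ * ∫ y, A y ∂(Measure.pi (fun _ : Fin n => gaussianReal θ 1)) ≤
      ⨆ μ : {μ : Fin n → ℝ // ∀ i, μ i ∈ Set.Icc (-1:ℝ) 1},
              ((⨆ β : Set.Icc (-M) M,
                  (1 / (n:ℝ)) * ∑ i, μ.1 i * PhiR (μ.1 i - (β : ℝ)))
                - ∫ y, (1 / (n:ℝ)) * ∑ i, μ.1 i * a y i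
                    ∂(Measure.pi fun i => gaussianReal (μ.1 i) 1)) := by
    intro θ β hθ hβ
    refine le_trans ?_ (le_ciSup hbdd ⟨fun _ => θ, fun _ => hθ⟩)
    have h1 := le_ciSup (f := fun β : Set.Icc (-M) M =>
      (1 / (n:ℝ)) * ∑ _i : Fin n, θ * PhiR (θ - (β : ℝ)))
      ⟨1, by rintro _ ⟨b, rfl⟩; exact W1 ⟨fun _ => θ, fun _ => hθ⟩ b⟩ ⟨β, hβ⟩
    have h2 : (1 / (n:ℝ)) * ∑ _i : Fin n, θ * PhiR (θ - β) = θ * PhiR (θ - β) := by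
      simp; field_simp
    have h3 : ∫ y, (1 / (n:ℝ)) * ∑ i, θ * a y i
        ∂(Measure.pi (fun _ : Fin n => gaussianReal θ 1)) =
        θ * ∫ y, A y ∂(Measure.pi (fun _ : Fin n => gaussianReal θ 1)) := by
      rw [← integral_const_mul]
      congr 1
      ext y
      rw [hA, ← Finset.mul_sum]; ring
    simp only at h1 ⊢
    rw [h2] at h1
    rw [h3]
    linarith
  have p1 := point δ (-M) ⟨by linarith, hδ1⟩ ⟨le_rfl, by linarith⟩
  have p2 := point (-δ) M ⟨by linarith, by linarith⟩ ⟨by linarith, le_rfl⟩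
  have tv := tv_bound n δ (κ / 2) (by positivity) A hAm hA01
  rw [hδ2] at tv
  have hexp : Real.exp (κ ^ 2 / 16) - 1 ≤ κ ^ 2 / 8 := by
    have hx : |κ ^ 2 / 16| ≤ 1 := by
      rw [abs_of_nonneg (by positivity)]; nlinarith
    have := (abs_le.1 (Real.abs_exp_sub_one_le hx)).2
    rw [abs_of_nonneg (by positivity)] at this
    linarith
  have htv2 : (Real.exp (κ ^ 2 / 16) - 1) / (2 * (κ / 2)) ≤ κ / 8 := by
    rw [div_le_iff₀ (by positivity)]; nlinarith
  have m1 : PhiR M < PhiR (δ - -M) := PhiR_lt (by linarith)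
  have m2 : PhiR (-δ - M) < PhiR (-M) := PhiR_lt (by linarith)
  have hc : κ ^ 2 / 32 / Real.sqrt n = δ * (κ / 4) := by rw [hδ]; ring
  rw [hc]
  set S := ⨆ μ : {μ : Fin n → ℝ // ∀ i, μ i ∈ Set.Icc (-1:ℝ) 1},
              ((⨆ β : Set.Icc (-M) M,
                  (1 / (n:ℝ)) * ∑ i, μ.1 i * PhiR (μ.1 i - (β : ℝ)))
                - ∫ y, (1 / (n:ℝ)) * ∑ i, μ.1 i * a y i
                    ∂(Measure.pi fun i => gaussianReal (μ.1 i) 1))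
  set I1 := ∫ y, A y ∂(Measure.pi (fun _ : Fin n => gaussianReal δ 1))
  set I2 := ∫ y, A y ∂(Measure.pi (fun _ : Fin n => gaussianReal (-δ) 1))
  have hfin : δ * (κ / 2) ≤ δ * (PhiR (δ - -M) - PhiR (-δ - M) - (I1 - I2)) :=
    mul_le_mul_of_nonneg_left (by linarith) hδ0.le
  nlinarith
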